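/- arXiv:1610.00818 — 4 statements merged into one kernel-verified Lean document; each statement's English description precedes it below -/
import Mathlib

section
/- (Lemma 6 of the paper, deterministic estimate on k_v^T − k_v^∞.) Let w̄ : [0,∞) → [1,∞), ε > 0 and K > 0 be such that for every absolutely continuous h : [0,∞) → ℝ with lim_{x→∞} h(x) = 0 and ‖h‖_{w̄} := (|h(0)|² + ∫_0^∞ |h'(x)|² w̄(x) dx)^{1/2} < ∞ and every T ≥ 0 one has ∫_T^∞ |h(x)| dx ≤ K · min(T^{-ε/2}, 1) · ‖h‖_{w̄} (with min(0^{-ε/2},1) := 1). Let t > 0, D₂ > 0, and for each s ∈ [0,t] and j ∈ ℕ let σ_s^j : [0,∞) → ℝ be absolutely continuous with lim_{u→∞} σ_s^j(u) = 0, jointly measurable in (s,u), with Σ_{j∈ℕ} ‖σ_s^j‖_{w̄}² ≤ D₂² for all s ∈ [0,t]. Then for every T ≥ t and every v ∈ [0,t], (1/2) | Σ_{j∈ℕ} ∫_0^v ( ∫_0^{T−s} σ_s^j(u) du + ∫_0^∞ σ_s^j(u) du ) · ( ∫_{T−s}^∞ σ_s^j(u) du ) ds | ≤ K² · min((T−t)^{-ε/2},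 1) · t · D₂². -/
open MeasureTheory Set Filter

/-- A series of integrals over `[0, v]` whose absolute partial sums are bounded pointwise by `M`
is summable, with sum at most `M * v` in absolute value. -/
theorem summable_intervalIntegral_of_sum_abs_le {ι : Type*} {F : ι → ℝ → ℝ} {v M : ℝ}
    (hv : 0 ≤ v) (hF : ∀ j, Measurable (F j))
    (hM : ∀ s ∈ Icc (0:ℝ) v, ∀ A : Finset ι, ∑ j ∈ A, |F j s| ≤ M) :
    Summable (fun j => ∫ s in (0:ℝ)..v, F j s) ∧ |∑' j, ∫ s in (0:ℝ)..v, F j s| ≤ M * v := by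
  have hint : ∀ j, IntervalIntegrable (F j) volume 0 v := by
    intro j
    rw [intervalIntegrable_iff_integrableOn_Ioc_of_le hv]
    refine Measure.integrableOn_of_bounded (M := M) measure_Ioc_lt_top.ne
      (hF j).aestronglyMeasurable ?_
    filter_upwards [ae_restrict_mem measurableSet_Ioc] with s hs
    simpa using hM s (Ioc_subset_Icc_self hs) {j}
  have hsum : ∀ A : Finset ι, ∑ j ∈ A, ∫ s in (0:ℝ)..v, |F j s| ≤ M * v := by
    intro A
    rw [← intervalIntegral.integral_finsetSum fun j _ => (hint j).abs]
    calc ∫ s in (0:ℝ)..v, ∑ j ∈ A, |F j s| ≤ ∫ _ in (0:ℝ)..v, M :=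
          intervalIntegral.integral_mono_on hv
            (by simpa [Finset.sum_fn] using IntervalIntegrable.sum A fun j _ => (hint j).abs)
            intervalIntegrable_const fun s hs => hM s hs A
      _ = M * v := by simp [mul_comm]
  have habs : ∀ j, |∫ s in (0:ℝ)..v, F j s| ≤ ∫ s in (0:ℝ)..v, |F j s| := fun j =>
    intervalIntegral.abs_integral_le_integral_abs hv
  have hS : Summable (fun j => ‖∫ s in (0:ℝ)..v, F j s‖) :=
    summable_of_sum_le (fun _ => norm_nonneg _)
      fun A => (Finset.sum_le_sum fun j _ => habs j).trans (hsum A)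
  refine ⟨hS.of_norm, (norm_tsum_le_tsum_norm hS).trans ?_⟩
  exact hS.tsum_le_of_sum_le fun A => (Finset.sum_le_sum fun j _ => habs j).trans (hsum A)

/-- Measurability in the parameter of a set integral over a jointly measurable family of sets. -/
theorem measurable_setIntegral_of_measurable_uncurry {f : ℝ × ℝ → ℝ} (hf : Measurable f)
    {S : ℝ → Set ℝ} (hS : MeasurableSet {p : ℝ × ℝ | p.2 ∈ S p.1}) :
    Measurable (fun s => ∫ u in S s, f (s, u)) := by
  have hSs : ∀ s, MeasurableSet (S s) := fun s => measurable_prodMk_left hS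
  have h := ((hf.indicator hS).stronglyMeasurable.integral_prod_right' (ν := volume)).measurable
  convert h using 2 with s
  rw [← integral_indicator (hSs s)]
  rfl

/-- Measurability in `s` of the difference of squares of the long-bond and bond volatilities. -/
theorem measurable_bond_volatility_mul {f : ℝ × ℝ → ℝ} (hf : Measurable f) (T : ℝ) :
    Measurable (fun s => ((∫ u in (0:ℝ)..(T - s), f (s, u)) + ∫ u in Ioi (0:ℝ), f (s, u)) *
      (∫ u in Ioi (T - s), f (s, u))) := by
  have hT : Measurable fun p : ℝ × ℝ => T - p.1 := by fun_prop
  simp only [intervalIntegral]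
  refine (((measurable_setIntegral_of_measurable_uncurry hf ?_).sub
    (measurable_setIntegral_of_measurable_uncurry hf ?_)).add
    (measurable_setIntegral_of_measurable_uncurry hf ?_)).mul
    (measurable_setIntegral_of_measurable_uncurry hf ?_)
  · exact (measurableSet_lt measurable_const measurable_snd).inter
      (measurableSet_le measurable_snd hT)
  · exact (measurableSet_lt hT measurable_snd).inter
      (measurableSet_le measurable_snd measurable_const)
  · exact measurableSet_lt measurable_const measurable_snd
  · exact measurableSet_lt hT measurable_snd

/-- Pointwise bound on the product of the summed integrals and the tail integral. -/
theorem abs_integral_add_mul_tail_le {h : ℝ → ℝ} {x y a b : ℝ} (hy : 0 ≤ y) (hyx : y ≤ x)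
    (hint : IntegrableOn (fun u => |h u|) (Ioi 0)) (ha : ∫ u in Ioi (0:ℝ), |h u| ≤ a)
    (hb : ∫ u in Ioi y, |h u| ≤ b) :
    |((∫ u in (0:ℝ)..x, h u) + ∫ u in Ioi (0:ℝ), h u) * (∫ u in Ioi x, h u)| ≤
      (2 * a) * b := by
  have hmono : ∀ {A B : Set ℝ}, A ⊆ B → B ⊆ Ioi 0 →
      ∫ u in A, |h u| ≤ ∫ u in B, |h u| := fun hAB hB =>
    setIntegral_mono_set (hint.mono_set hB) (ae_of_all _ fun _ => abs_nonneg _)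
      hAB.eventuallyLE
  have h1 : |∫ u in (0:ℝ)..x, h u| ≤ a := by
    rw [intervalIntegral.integral_of_le (hy.trans hyx)]
    exact abs_integral_le_integral_abs.trans
      ((hmono Ioc_subset_Ioi_self subset_rfl).trans ha)
  have h2 : |∫ u in Ioi (0:ℝ), h u| ≤ a := abs_integral_le_integral_abs.trans ha
  have h3 : |∫ u in Ioi x, h u| ≤ b := abs_integral_le_integral_abs.trans
    ((hmono (Ioi_subset_Ioi hyx) (Ioi_subset_Ioi hy)).trans hb)
  rw [abs_mul]
  have h4 := abs_add_le (∫ u in (0:ℝ)..x, h u) (∫ u in Ioi (0:ℝ), h u)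
  have h5 := (abs_nonneg _).trans h1
  exact mul_le_mul (by linarith) h3 (abs_nonneg _) (by linarith)

/-- Lemma 6: deterministic estimate
`sup_{v ≤ t} |k_v^T − k_v^∞| ≤ K² C(T−t) t D₂²`, where
`k_v^T = (1/2)∫_0^v ‖σ_s^T‖² ds`, `σ_s^{T,j} = ∫_0^{T−s} σ_s^j(u)du`,
`σ_s^{∞,j} = ∫_0^∞ σ_s^j(u)du`, and `C(x) = min(x^{-ε/2},1)` (`:=1` at `x=0`). -/
theorem stmt_7
    (wbar : ℝ → ℝ) (hwbar_ge : ∀ x ∈ Ici (0:ℝ), 1 ≤ wbar x) (hwbar_meas : Measurable wbar)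
    (ε K : ℝ) (hε : 0 < ε) (hK : 0 < K)
    (hKprop : ∀ h h' : ℝ → ℝ,
      (∀ x ≥ (0:ℝ), IntegrableOn h' (Icc 0 x)) →
      (∀ x ≥ (0:ℝ), h x = h 0 + ∫ s in (0:ℝ)..x, h' s) →
      IntegrableOn (fun x => |h' x| ^ 2 * wbar x) (Ioi 0) →
      Tendsto h atTop (nhds 0) →
      ∀ T ≥ (0:ℝ),
        IntegrableOn (fun x => |h x|) (Ioi T) ∧
        ∫ x in Ioi T, |h x| ≤
          K * (if T = 0 then 1 else min (T ^ (-(ε / 2))) 1) *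
            Real.sqrt (|h 0| ^ 2 + ∫ x in Ioi (0:ℝ), |h' x| ^ 2 * wbar x))
    (t D₂ : ℝ) (ht : 0 < t) (hD₂ : 0 < D₂)
    (σ σ' : ℝ → ℕ → ℝ → ℝ)
    (hmeas : ∀ j, Measurable (fun p : ℝ × ℝ => σ p.1 j p.2))
    (hσloc : ∀ s ∈ Icc (0:ℝ) t, ∀ j, ∀ x ≥ (0:ℝ), IntegrableOn (σ' s j) (Icc 0 x))
    (hσac : ∀ s ∈ Icc (0:ℝ) t, ∀ j, ∀ x ≥ (0:ℝ),
      σ s j x = σ s j 0 + ∫ u in (0:ℝ)..x, σ' s j u)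
    (hσlim : ∀ s ∈ Icc (0:ℝ) t, ∀ j, Tendsto (σ s j) atTop (nhds 0))
    (hσint : ∀ s ∈ Icc (0:ℝ) t, ∀ j,
      IntegrableOn (fun u => |σ' s j u| ^ 2 * wbar u) (Ioi 0))
    (hHS : ∀ s ∈ Icc (0:ℝ) t,
      (∑' j : ℕ, ENNReal.ofReal (|σ s j 0| ^ 2 + ∫ u in Ioi (0:ℝ), |σ' s j u| ^ 2 * wbar u))
        ≤ ENNReal.ofReal (D₂ ^ 2)) :
    ∀ T ≥ t, ∀ v ∈ Icc (0:ℝ) t,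
      Summable (fun j : ℕ => ∫ s in (0:ℝ)..v,
        ((∫ u in (0:ℝ)..(T - s), σ s j u) + ∫ u in Ioi (0:ℝ), σ s j u) *
          (∫ u in Ioi (T - s), σ s j u)) ∧
      (1/2) * |∑' j : ℕ, ∫ s in (0:ℝ)..v,
          ((∫ u in (0:ℝ)..(T - s), σ s j u) + ∫ u in Ioi (0:ℝ), σ s j u) *
            (∫ u in Ioi (T - s), σ s j u)|
        ≤ K ^ 2 * (if T - t = 0 then 1 else min ((T - t) ^ (-(ε / 2))) 1) * t * D₂ ^ 2 := by
  intro T hT v hv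
  set C : ℝ := if T - t = 0 then 1 else min ((T - t) ^ (-(ε / 2))) 1 with hC
  have hTt : 0 ≤ T - t := sub_nonneg.2 hT
  have hC0 : 0 ≤ C := by
    rw [hC]
    split_ifs
    · exact zero_le_one
    · exact le_min (Real.rpow_nonneg hTt _) zero_le_one
  let a : ℝ → ℕ → ℝ := fun s j => |σ s j 0| ^ 2 + ∫ u in Ioi (0:ℝ), |σ' s j u| ^ 2 * wbar u
  have ha0 : ∀ s j, 0 ≤ a s j := fun s j => add_nonneg (sq_nonneg _)
    (setIntegral_nonneg measurableSet_Ioi fun u hu =>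
      mul_nonneg (sq_nonneg _) (zero_le_one.trans (hwbar_ge u (Ioi_subset_Ici_self hu))))
  have hasum : ∀ s ∈ Icc (0:ℝ) t, ∀ A : Finset ℕ, ∑ j ∈ A, a s j ≤ D₂ ^ 2 := by
    intro s hs A
    rw [← ENNReal.ofReal_le_ofReal_iff (sq_nonneg _),
      ENNReal.ofReal_sum_of_nonneg fun j _ => ha0 s j]
    exact (ENNReal.sum_le_tsum A).trans (hHS s hs)
  have hbound : ∀ s ∈ Icc (0:ℝ) t, ∀ j,
      |((∫ u in (0:ℝ)..(T - s), σ s j u) + ∫ u in Ioi (0:ℝ), σ s j u) *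
        (∫ u in Ioi (T - s), σ s j u)| ≤ 2 * K ^ 2 * C * a s j := by
    intro s hs j
    have hK' := hKprop (σ s j) (σ' s j) (hσloc s hs j) (hσac s hs j) (hσint s hs j) (hσlim s hs j)
    obtain ⟨hint, h0⟩ := hK' 0 le_rfl
    have htail := (hK' (T - t) hTt).2
    rw [if_pos rfl] at h0
    refine (abs_integral_add_mul_tail_le hTt (by linarith [hs.2]) hint h0 htail).trans_eq ?_
    have hsq : √(a s j) * √(a s j) = a s j := Real.mul_self_sqrt (ha0 s j)
    change 2 * (K * 1 * √(a s j)) * (K * C * √(a s j)) = _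
    linear_combination 2 * K ^ 2 * C * hsq
  have hKC : 0 ≤ 2 * K ^ 2 * C := by positivity
  obtain ⟨hS, hle⟩ := summable_intervalIntegral_of_sum_abs_le (M := 2 * K ^ 2 * C * D₂ ^ 2) hv.1
    (fun j => measurable_bond_volatility_mul (hmeas j) T) fun s hs A => by
      have hs' : s ∈ Icc (0:ℝ) t := ⟨hs.1, hs.2.trans hv.2⟩
      refine (Finset.sum_le_sum fun j _ => hbound s hs' j).trans ?_
      rw [← Finset.mul_sum]
      exact mul_le_mul_of_nonneg_left (hasum s hs' A) hKC
  refine ⟨hS, ?_⟩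
  have hvt : 2 * K ^ 2 * C * D₂ ^ 2 * v ≤ 2 * K ^ 2 * C * D₂ ^ 2 * t :=
    mul_le_mul_of_nonneg_left hv.2 (by positivity)
  linarith
end

section
/- (Quadratic bound for the HJM drift operator S.) Let w : [0,∞) → [1,∞) be a non-decreasing C¹ function with ∫_0^∞ w(x)^{-1/3} dx < ∞. Then there exists a constant K > 0, depending only on w, such that for every absolutely continuous h : [0,∞) → ℝ with locally integrable derivative h', ∫_0^∞ |h'(x)|² w(x) dx < ∞ and lim_{x→∞} h(x) = 0, the function (Sh)(x) := h(x) · ∫_0^x h(η) dη is absolutely continuous, tends to 0 as x → ∞, satisfies ∫_0^∞ |(Sh)'(x)|² w(x) dx < ∞, and ‖Sh‖_w ≤ K ‖h‖_w², where ‖g‖_w := (|g(0)|² + ∫_0^∞ |g'(x)|² w(x) dx)^{1/2}. -/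
open MeasureTheory Set Filter

/-- Integration by parts for two primitives vanishing at the left endpoint. -/
theorem integral_mul_primitive_add_primitive_mul {f g : ℝ → ℝ} {a b : ℝ}
    (hf : IntervalIntegrable f volume a b) (hg : IntervalIntegrable g volume a b) :
    ∫ x in a..b, (f x * (∫ t in a..x, g t) + (∫ t in a..x, f t) * g x) =
      (∫ t in a..b, f t) * ∫ t in a..b, g t := by
  have hu := hf.absolutelyContinuousOnInterval_intervalIntegral (c := a) left_mem_uIcc
  have hv := hg.absolutelyContinuousOnInterval_intervalIntegral (c := a) left_mem_uIcc
  have key := hu.integral_deriv_mul_eq_sub hv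
  simp only [intervalIntegral.integral_same, mul_zero, sub_zero] at key
  rw [← key]
  apply intervalIntegral.integral_congr_ae
  filter_upwards [hf.ae_hasDerivAt_integral, hg.ae_hasDerivAt_integral] with x h1 h2 hx
  rw [(h1 (uIoc_subset_uIcc hx) a left_mem_uIcc).deriv,
    (h2 (uIoc_subset_uIcc hx) a left_mem_uIcc).deriv]

/-- Weighted Cauchy–Schwarz inequality. -/
theorem sq_setIntegral_abs_le {α : Type*} [MeasurableSpace α] {μ : Measure α} {s : Set α}
    (hs : MeasurableSet s) {f p : α → ℝ} (hp : ∀ x ∈ s, 0 < p x) (hf : IntegrableOn f s μ)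
    (hfp : IntegrableOn (fun x => |f x| ^ 2 * p x) s μ)
    (hpinv : IntegrableOn (fun x => (p x)⁻¹) s μ) :
    (∫ x in s, |f x| ∂μ) ^ 2 ≤ (∫ x in s, |f x| ^ 2 * p x ∂μ) * ∫ x in s, (p x)⁻¹ ∂μ := by
  have habs : IntegrableOn (fun x => |f x|) s μ := hf.abs
  have key : ∀ t : ℝ, 0 ≤ (∫ x in s, |f x| ^ 2 * p x ∂μ) * (t * t) +
      (-2 * ∫ x in s, |f x| ∂μ) * t + ∫ x in s, (p x)⁻¹ ∂μ := by
    intro t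
    have e : (∫ x in s, |f x| ^ 2 * p x ∂μ) * (t * t) +
        (-2 * ∫ x in s, |f x| ∂μ) * t + ∫ x in s, (p x)⁻¹ ∂μ =
        ∫ x in s, (|f x| ^ 2 * p x * (t * t) + |f x| * (-2 * t) + (p x)⁻¹) ∂μ := by
      have hsum : IntegrableOn (fun x => |f x| ^ 2 * p x * (t * t) + |f x| * (-2 * t)) s μ :=
        (hfp.mul_const _).add (habs.mul_const _)
      rw [integral_add hsum hpinv,
        integral_add (hfp.mul_const _) (habs.mul_const _), integral_mul_const,
        integral_mul_const]
      ring
    rw [e]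
    refine setIntegral_nonneg hs fun x hx => ?_
    have h0 := hp x hx
    have : |f x| ^ 2 * p x * (t * t) + |f x| * (-2 * t) + (p x)⁻¹ =
        (|f x| * t * p x - 1) ^ 2 * (p x)⁻¹ := by
      field_simp
      ring
    rw [this]
    positivity
  have := discrim_le_zero key
  rw [discrim] at this
  nlinarith

/-- A function with weighted square integrable derivative that vanishes at infinity is dominated
by the inverse cube root `c` of the weight. -/
theorem abs_le_sqrt_mul_of_weighted_deriv {w c h h' : ℝ → ℝ}
    (hc_pos : ∀ x ∈ Ici (0 : ℝ), 0 < c x) (hc_anti : AntitoneOn c (Ici 0))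
    (hcw : ∀ x ∈ Ici (0 : ℝ), (w x)⁻¹ = c x ^ 3)
    (hc_int : IntegrableOn c (Ioi 0)) (hw_int : IntegrableOn (fun x => (w x)⁻¹) (Ioi 0))
    (hh' : ∀ x ≥ (0 : ℝ), IntegrableOn h' (Icc 0 x))
    (hh : ∀ x ≥ (0 : ℝ), h x = h 0 + ∫ s in (0 : ℝ)..x, h' s)
    (hA : IntegrableOn (fun x => |h' x| ^ 2 * w x) (Ioi 0))
    (hlim : Tendsto h atTop (nhds 0)) {x : ℝ} (hx : 0 ≤ x) :
    |h x| ≤ √((∫ x in Ioi (0 : ℝ), |h' x| ^ 2 * w x) * ∫ x in Ioi (0 : ℝ), c x) * c x := by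
  have hw_pos : ∀ y ∈ Ici (0 : ℝ), 0 < w y := fun y hy => by
    rw [← inv_pos, hcw y hy]
    exact pow_pos (hc_pos y hy) 3
  set A := ∫ x in Ioi (0 : ℝ), |h' x| ^ 2 * w x
  set I := ∫ x in Ioi (0 : ℝ), c x
  have hfin : ∀ y ≥ x, (h y - h x) ^ 2 ≤ A * (c x ^ 2 * I) := by
    intro y hy
    have hsub : Ioc x y ⊆ Ioi 0 := fun z hz => lt_of_le_of_lt hx hz.1
    have hsub' : Ioc x y ⊆ Ici 0 := hsub.trans Ioi_subset_Ici_self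
    have hy0 : 0 ≤ y := hx.trans hy
    have hi : ∀ z ≥ (0 : ℝ), IntervalIntegrable h' volume 0 z := fun z hz =>
      (hh' z hz |>.mono_set (uIcc_of_le hz).subset).intervalIntegrable
    have hd : |h y - h x| ≤ ∫ s in Ioc x y, |h' s| := by
      have : h y - h x = ∫ s in x..y, h' s := by
        rw [← intervalIntegral.integral_interval_sub_left (hi y hy0) (hi x hx), hh y hy0, hh x hx]
        ring
      rw [this, intervalIntegral.integral_of_le hy]
      exact abs_integral_le_integral_abs
    have hcs := sq_setIntegral_abs_le measurableSet_Ioc (fun z hz => hw_pos z (hsub' hz))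
      ((hh' y hy0).mono_set fun z hz => ⟨hsub' hz, hz.2⟩) (hA.mono_set hsub)
      (hw_int.mono_set hsub)
    have hA_le : ∫ s in Ioc x y, |h' s| ^ 2 * w s ≤ A :=
      setIntegral_mono_set hA ((ae_restrict_iff' measurableSet_Ioi).2 <| .of_forall fun z hz =>
        mul_nonneg (sq_nonneg _) (hw_pos z (Ioi_subset_Ici_self hz)).le)
        (LE.le.eventuallyLE hsub)
    have hI_le : ∫ s in Ioc x y, (w s)⁻¹ ≤ c x ^ 2 * I := by
      calc ∫ s in Ioc x y, (w s)⁻¹ ≤ ∫ s in Ioc x y, c x ^ 2 * c s := by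
            refine setIntegral_mono_on (hw_int.mono_set hsub)
              ((hc_int.mono_set hsub).const_mul _) measurableSet_Ioc fun z hz => ?_
            have h1 := hc_pos z (hsub' hz)
            have h2 := hc_anti hx (hsub' hz) hz.1.le
            rw [hcw z (hsub' hz), pow_succ]
            gcongr
        _ = c x ^ 2 * ∫ s in Ioc x y, c s := integral_const_mul _ _
        _ ≤ c x ^ 2 * I := by
            refine mul_le_mul_of_nonneg_left ?_ (sq_nonneg _)
            exact setIntegral_mono_set hc_int
              ((ae_restrict_iff' measurableSet_Ioi).2 <| .of_forall fun z hz =>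
                (hc_pos z (Ioi_subset_Ici_self hz)).le)
              (LE.le.eventuallyLE hsub)
    calc (h y - h x) ^ 2 = |h y - h x| ^ 2 := (sq_abs _).symm
      _ ≤ (∫ s in Ioc x y, |h' s|) ^ 2 := by gcongr
      _ ≤ _ := hcs
      _ ≤ _ := by
        refine mul_le_mul hA_le hI_le ?_ ?_
        · exact setIntegral_nonneg measurableSet_Ioc fun z hz =>
            (inv_pos.2 (hw_pos z (hsub' hz))).le
        · exact setIntegral_nonneg measurableSet_Ioi fun z hz =>
            mul_nonneg (sq_nonneg _) (hw_pos z (Ioi_subset_Ici_self hz)).le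
  have hsq : (0 - h x) ^ 2 ≤ A * (c x ^ 2 * I) :=
    le_of_tendsto ((hlim.sub_const (h x)).pow 2) ((eventually_ge_atTop x).mono hfin)
  have hcx := hc_pos x hx
  rw [← Real.sqrt_sq hcx.le, ← Real.sqrt_mul' _ (sq_nonneg _)]
  refine Real.abs_le_sqrt ?_
  linarith

open MeasureTheory Set Filter

/-- quadratic bound for the HJM drift operator `S`:
there is `K > 0` (depending only on `w`) such that for every `h ∈ H_w^0`, the function
`(Sh)(x) = h(x)∫_0^x h` is absolutely continuous with derivative
`(Sh)'(x) = h'(x)∫_0^x h + h(x)²`, tends to `0` at infinity, has `∫_0^∞ |(Sh)'|² w < ∞`,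
and `‖Sh‖_w ≤ K ‖h‖_w²`. -/
theorem stmt_13
    (w : ℝ → ℝ) (hw_c1 : ContDiffOn ℝ 1 w (Ici 0))
    (hw_mono : MonotoneOn w (Ici 0)) (hw_ge : ∀ x ∈ Ici (0:ℝ), 1 ≤ w x)
    (hw_int : IntegrableOn (fun x => w x ^ (-(1/3) : ℝ)) (Ioi 0)) :
    ∃ K > (0:ℝ), ∀ h h' : ℝ → ℝ,
      (∀ x ≥ (0:ℝ), IntegrableOn h' (Icc 0 x)) →
      (∀ x ≥ (0:ℝ), h x = h 0 + ∫ s in (0:ℝ)..x, h' s) →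
      IntegrableOn (fun x => |h' x| ^ 2 * w x) (Ioi 0) →
      Tendsto h atTop (nhds 0) →
      (∀ x ≥ (0:ℝ),
        IntegrableOn (fun y => h' y * (∫ η in (0:ℝ)..y, h η) + (h y) ^ 2) (Icc 0 x)) ∧
      (∀ x ≥ (0:ℝ), h x * (∫ η in (0:ℝ)..x, h η) =
        h 0 * (∫ η in (0:ℝ)..(0:ℝ), h η) +
          ∫ y in (0:ℝ)..x, (h' y * (∫ η in (0:ℝ)..y, h η) + (h y) ^ 2)) ∧
      Tendsto (fun x => h x * ∫ η in (0:ℝ)..x, h η) atTop (nhds 0) ∧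
      IntegrableOn
        (fun x => |h' x * (∫ η in (0:ℝ)..x, h η) + (h x) ^ 2| ^ 2 * w x) (Ioi 0) ∧
      Real.sqrt (|h 0 * (∫ η in (0:ℝ)..(0:ℝ), h η)| ^ 2 +
          ∫ x in Ioi (0:ℝ), |h' x * (∫ η in (0:ℝ)..x, h η) + (h x) ^ 2| ^ 2 * w x)
        ≤ K * (Real.sqrt (|h 0| ^ 2 + ∫ x in Ioi (0:ℝ), |h' x| ^ 2 * w x)) ^ 2 := by
  have hw_pos : ∀ y ∈ Ici (0 : ℝ), 0 < w y := fun y hy => one_pos.trans_le (hw_ge y hy)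
  set c : ℝ → ℝ := fun x => w x ^ (-(1 / 3) : ℝ) with hc
  have hc_pos : ∀ x ∈ Ici (0 : ℝ), 0 < c x := fun x hx => Real.rpow_pos_of_pos (hw_pos x hx) _
  have hc_anti : AntitoneOn c (Ici 0) := fun x hx y hy hxy =>
    Real.rpow_le_rpow_of_nonpos (hw_pos x hx) (hw_mono hx hy hxy) (by norm_num)
  have hc_one : ∀ x ∈ Ici (0 : ℝ), c x ≤ 1 := fun x hx =>
    Real.rpow_le_one_of_one_le_of_nonpos (hw_ge x hx) (by norm_num)
  have hcw : ∀ x ∈ Ici (0 : ℝ), (w x)⁻¹ = c x ^ 3 := fun x hx => by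
    rw [hc, ← Real.rpow_natCast, ← Real.rpow_mul (hw_pos x hx).le]
    norm_num [Real.rpow_neg_one]
  have hw_cont : ContinuousOn w (Ici 0) := hw_c1.continuousOn
  have hw_meas : AEStronglyMeasurable w (volume.restrict (Ioi 0)) :=
    (hw_cont.mono Ioi_subset_Ici_self).aestronglyMeasurable measurableSet_Ioi
  have hwinv_int : IntegrableOn (fun x => (w x)⁻¹) (Ioi 0) := by
    refine hw_int.mono' hw_meas.aemeasurable.inv.aestronglyMeasurable
      ((ae_restrict_iff' measurableSet_Ioi).2 <| .of_forall fun x hx => ?_)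
    have hx' : x ∈ Ici (0 : ℝ) := Ioi_subset_Ici_self hx
    rw [Real.norm_of_nonneg (inv_pos.2 (hw_pos x hx')).le, hcw x hx']
    exact pow_le_of_le_one (hc_pos x hx').le (hc_one x hx') (by norm_num)
  set I := ∫ x in Ioi (0 : ℝ), c x
  have hI0 : 0 ≤ I :=
    setIntegral_nonneg measurableSet_Ioi fun z hz => (hc_pos z (Ioi_subset_Ici_self hz)).le
  refine ⟨√(4 * I ^ 3) + 1, by positivity, fun h h' hh' hh hA_int hlim => ?_⟩
  have hbound : ∀ x ∈ Ici (0 : ℝ), |h x| ≤ _ := fun x hx =>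
    abs_le_sqrt_mul_of_weighted_deriv hc_pos hc_anti hcw hw_int hwinv_int hh' hh hA_int hlim hx
  set A := ∫ x in Ioi (0 : ℝ), |h' x| ^ 2 * w x
  have hA0 : 0 ≤ A := setIntegral_nonneg measurableSet_Ioi fun z hz =>
    mul_nonneg (sq_nonneg _) (hw_pos z (Ioi_subset_Ici_self hz)).le
  set F : ℝ → ℝ := fun x => ∫ η in (0 : ℝ)..x, h η with hF
  have hh'_ii : ∀ x ≥ (0 : ℝ), IntervalIntegrable h' volume 0 x := fun x hx =>
    (hh' x hx |>.mono_set (uIcc_of_le hx).subset).intervalIntegrable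
  have hh_cont_Icc : ∀ x ≥ (0 : ℝ), ContinuousOn h (Icc 0 x) := fun x hx => by
    have := intervalIntegral.continuousOn_primitive_interval
      ((hh' x hx).mono_set (uIcc_of_le hx).subset)
    rw [uIcc_of_le hx] at this
    exact (this.const_add (h 0)).congr fun y hy => hh y hy.1
  have hh_ii : ∀ x ≥ (0 : ℝ), IntervalIntegrable h volume 0 x := fun x hx =>
    ((hh_cont_Icc x hx).mono (uIcc_of_le hx).subset).intervalIntegrable
  have hF_cont_Icc : ∀ x ≥ (0 : ℝ), ContinuousOn F (Icc 0 x) := fun x hx => by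
    have := intervalIntegral.continuousOn_primitive_interval'
      (hh_ii x hx) left_mem_uIcc
    rwa [uIcc_of_le hx] at this
  have hD_Icc : ∀ x ≥ (0 : ℝ), IntegrableOn (fun y => h' y * F y + h y ^ 2) (Icc 0 x) :=
    fun x hx => ((hh' x hx).mul_continuousOn (hF_cont_Icc x hx) isCompact_Icc).add
      ((hh_cont_Icc x hx).pow 2).integrableOn_Icc
  have hF_bound : ∀ x ∈ Ici (0 : ℝ), |F x| ≤ √(A * I) * I := by
    intro x hx
    have hsub : Ioc 0 x ⊆ Ioi (0 : ℝ) := fun z hz => hz.1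
    calc |F x| ≤ ∫ s in Ioc 0 x, |h s| := by
          rw [hF]
          simp only
          rw [intervalIntegral.integral_of_le hx]
          exact abs_integral_le_integral_abs
      _ ≤ ∫ s in Ioc 0 x, √(A * I) * c s :=
          setIntegral_mono_on (hh_ii x hx).1.abs ((hw_int.mono_set hsub).const_mul _)
            measurableSet_Ioc fun z hz => hbound z hz.1.le
      _ = √(A * I) * ∫ s in Ioc 0 x, c s := integral_const_mul _ _
      _ ≤ √(A * I) * I := by
          refine mul_le_mul_of_nonneg_left ?_ (Real.sqrt_nonneg _)
          exact setIntegral_mono_set hw_int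
            ((ae_restrict_iff' measurableSet_Ioi).2 <| .of_forall fun z hz =>
              (hc_pos z (Ioi_subset_Ici_self hz)).le)
            (LE.le.eventuallyLE hsub)
  have hpt : ∀ x ∈ Ioi (0 : ℝ), |h' x * F x + h x ^ 2| ^ 2 * w x ≤
      2 * (A * I ^ 3) * (|h' x| ^ 2 * w x) + 2 * (A * I) ^ 2 * c x := by
    intro x hx
    have hx' : x ∈ Ici (0 : ℝ) := Ioi_subset_Ici_self hx
    have hw0 := hw_pos x hx'
    have hAI : 0 ≤ A * I := mul_nonneg hA0 hI0
    have hF2 : F x ^ 2 ≤ A * I ^ 3 := by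
      calc F x ^ 2 = |F x| ^ 2 := (sq_abs _).symm
        _ ≤ (√(A * I) * I) ^ 2 := by gcongr; exact hF_bound x hx'
        _ = A * I ^ 3 := by rw [mul_pow, Real.sq_sqrt hAI]; ring
    have hh4 : h x ^ 4 ≤ (A * I) ^ 2 * c x ^ 4 := by
      calc h x ^ 4 = |h x| ^ 4 := (Even.pow_abs (by decide) _).symm
        _ ≤ (√(A * I) * c x) ^ 4 := by gcongr; exact hbound x hx'
        _ = (√(A * I) ^ 2) ^ 2 * c x ^ 4 := by ring
        _ = (A * I) ^ 2 * c x ^ 4 := by rw [Real.sq_sqrt hAI]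
    have hc4 : c x ^ 4 * w x = c x := by
      have := hcw x hx'
      rw [pow_succ', ← this]
      field_simp
    rw [sq_abs, sq_abs]
    calc (h' x * F x + h x ^ 2) ^ 2 * w x
        ≤ (2 * (F x ^ 2 * h' x ^ 2) + 2 * h x ^ 4) * w x := by
          gcongr
          nlinarith [sq_nonneg (h' x * F x - h x ^ 2)]
      _ ≤ (2 * (A * I ^ 3 * h' x ^ 2) + 2 * ((A * I) ^ 2 * c x ^ 4)) * w x := by gcongr
      _ = 2 * (A * I ^ 3) * (h' x ^ 2 * w x) + 2 * (A * I) ^ 2 * (c x ^ 4 * w x) := by ring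
      _ = _ := by rw [hc4]
  have hdom : IntegrableOn
      (fun x => 2 * (A * I ^ 3) * (|h' x| ^ 2 * w x) + 2 * (A * I) ^ 2 * c x) (Ioi 0) :=
    (hA_int.const_mul _).add (hw_int.const_mul _)
  have hD_meas : AEStronglyMeasurable (fun y => h' y * F y + h y ^ 2)
      (volume.restrict (Ioi 0)) := by
    have hU : (Ioi (0 : ℝ)) ⊆ ⋃ n : ℕ, Icc (0 : ℝ) n := fun x hx => by
      obtain ⟨n, hn⟩ := exists_nat_ge x
      exact mem_iUnion.2 ⟨n, le_of_lt hx, hn⟩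
    exact (aestronglyMeasurable_iUnion_iff.2 fun n : ℕ =>
      (hD_Icc n n.cast_nonneg).aestronglyMeasurable).mono_set hU
  have hS_int : IntegrableOn (fun x => |h' x * F x + h x ^ 2| ^ 2 * w x) (Ioi 0) := by
    refine hdom.mono' ((hD_meas.norm.pow 2).mul hw_meas)
      ((ae_restrict_iff' measurableSet_Ioi).2 <| .of_forall fun x hx => ?_)
    rw [Real.norm_of_nonneg
      (mul_nonneg (sq_nonneg _) (hw_pos x (Ioi_subset_Ici_self hx)).le)]
    exact hpt x hx
  refine ⟨hD_Icc, fun x hx => ?_, ?_, hS_int, ?_⟩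
  · have key := integral_mul_primitive_add_primitive_mul (hh'_ii x hx) (hh_ii x hx)
    have hcongr : ∫ y in (0 : ℝ)..x, (h' y * F y + h y ^ 2) =
        ∫ y in (0 : ℝ)..x, ((h' y * F y + (∫ t in (0 : ℝ)..y, h' t) * h y) + h 0 * h y) := by
      refine intervalIntegral.integral_congr fun y hy => ?_
      rw [uIcc_of_le hx] at hy
      have := hh y hy.1
      rw [eq_sub_of_add_eq' this.symm]
      ring
    have hii : IntervalIntegrable
        (fun y => h' y * F y + (∫ t in (0 : ℝ)..y, h' t) * h y) volume 0 x := by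
      refine ((hh'_ii x hx).mul_continuousOn ?_).add ((hh_ii x hx).continuousOn_mul ?_)
      · rw [uIcc_of_le hx]
        exact hF_cont_Icc x hx
      · exact intervalIntegral.continuousOn_primitive_interval' (hh'_ii x hx) left_mem_uIcc
    rw [hcongr, intervalIntegral.integral_add hii ((hh_ii x hx).const_mul _),
      intervalIntegral.integral_const_mul, key, hh x hx]
    simp only [intervalIntegral.integral_same]
    ring
  · refine hlim.zero_mul_isBoundedUnder_le ⟨√(A * I) * I, ?_⟩
    rw [eventually_map]
    exact (eventually_ge_atTop 0).mono fun x hx => hF_bound x hx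
  · have hle : ∫ x in Ioi (0 : ℝ), |h' x * F x + h x ^ 2| ^ 2 * w x ≤ 4 * I ^ 3 * A ^ 2 := by
      calc _ ≤ ∫ x in Ioi (0 : ℝ),
            (2 * (A * I ^ 3) * (|h' x| ^ 2 * w x) + 2 * (A * I) ^ 2 * c x) :=
            setIntegral_mono_on hS_int hdom measurableSet_Ioi hpt
        _ = 2 * (A * I ^ 3) * A + 2 * (A * I) ^ 2 * I := by
            rw [integral_add (hA_int.const_mul _) (hw_int.const_mul _), integral_const_mul,
              integral_const_mul]
        _ = 4 * I ^ 3 * A ^ 2 := by ring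
    rw [Real.sq_sqrt (by positivity), intervalIntegral.integral_same, mul_zero, abs_zero,
      zero_pow two_ne_zero, zero_add]
    calc _ ≤ √(4 * I ^ 3 * A ^ 2) := Real.sqrt_le_sqrt hle
      _ = √(4 * I ^ 3) * A := by rw [Real.sqrt_mul' _ (sq_nonneg _), Real.sqrt_sq hA0]
      _ ≤ (√(4 * I ^ 3) + 1) * (|h 0| ^ 2 + A) := by
          gcongr
          · linarith
          · linarith [sq_nonneg |h 0|]
end

section
/- (Local Lipschitz continuity of the HJM drift operator S.) Let w : [0,∞) → [1,∞) be a non-decreasing C¹ function with ∫_0^∞ w(x)^{-1/3} dx < ∞. Then there exists a constant C > 0, depending only on w, such that for all absolutely continuous g, h : [0,∞) → ℝ with locally integrable derivatives, finite norms ‖g‖_w, ‖h‖_w < ∞ (where ‖f‖_w := (|f(0)|² + ∫_0^∞ |f'(x)|² w(x) dx)^{1/2}) and lim_{x→∞} g(x) = lim_{x→∞} h(x) = 0, one has ‖Sg − Sh‖_w ≤ C (‖g‖_w + ‖h‖_w) ‖g − h‖_w, where (Sf)(x) := f(x) · ∫_0^x f(η) dη. -/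
open MeasureTheory Set Filter

/-- The weighted space `H_w^0`: `f` is a primitive of `f'` on `[0, ∞)`, vanishes at infinity, and
`∫_0^∞ |f'|² w` is finite. -/
structure MemWeighted (w f f' : ℝ → ℝ) : Prop where
  integrableOn_Icc : ∀ x ≥ (0:ℝ), IntegrableOn f' (Icc 0 x)
  eq_add_integral : ∀ x ≥ (0:ℝ), f x = f 0 + ∫ s in (0:ℝ)..x, f' s
  integrableOn_sq_mul : IntegrableOn (fun x => |f' x| ^ 2 * w x) (Ioi 0)
  tendsto_zero : Tendsto f atTop (nhds 0)

/-- The norm `‖f‖_w = (|f(0)|² + ∫_0^∞ |f'|² w)^{1/2}`. -/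
noncomputable def weightedNorm (w f f' : ℝ → ℝ) : ℝ :=
  Real.sqrt (|f 0| ^ 2 + ∫ x in Ioi (0:ℝ), |f' x| ^ 2 * w x)

lemma weightedNorm_nonneg (w f f' : ℝ → ℝ) : 0 ≤ weightedNorm w f f' := Real.sqrt_nonneg _

lemma integral_sq_mul_le_weightedNorm_sq {w : ℝ → ℝ} (hw_ge : ∀ x ∈ Ici (0:ℝ), 1 ≤ w x)
    (f f' : ℝ → ℝ) : ∫ x in Ioi (0:ℝ), |f' x| ^ 2 * w x ≤ weightedNorm w f f' ^ 2 := by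
  have h0 : 0 ≤ ∫ x in Ioi (0:ℝ), |f' x| ^ 2 * w x :=
    setIntegral_nonneg measurableSet_Ioi fun x hx =>
      mul_nonneg (by positivity) (zero_le_one.trans (hw_ge x (mem_Ioi.1 hx).le))
  rw [weightedNorm, Real.sq_sqrt (by positivity)]
  linarith [sq_nonneg |f 0|]

lemma rpow_neg_third_pow_three {a : ℝ} (ha : 1 ≤ a) : a * (a ^ (-(1/3) : ℝ)) ^ 3 = 1 := by
  have h0 : 0 < a := by linarith
  rw [← Real.rpow_natCast (a ^ (-(1/3) : ℝ)) 3, ← Real.rpow_mul h0.le]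
  norm_num
  rw [Real.rpow_neg_one]
  field_simp

lemma continuousOn_primitive_Ici {f : ℝ → ℝ} (hf : ∀ x ≥ (0:ℝ), IntegrableOn f (Icc 0 x)) :
    ContinuousOn (fun x => ∫ s in (0:ℝ)..x, f s) (Ici 0) := by
  intro x hx
  have hx0 : (0:ℝ) ≤ x + 1 := by linarith [mem_Ici.1 hx]
  have h1 : ContinuousOn (fun y => ∫ s in (0:ℝ)..y, f s) (uIcc 0 (x + 1)) :=
    intervalIntegral.continuousOn_primitive_interval (by
      rw [uIcc_of_le hx0]
      exact hf _ hx0)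
  rw [uIcc_of_le hx0] at h1
  refine (h1 x ⟨hx, by linarith⟩).mono_of_mem_nhdsWithin ?_
  filter_upwards [self_mem_nhdsWithin, mem_nhdsWithin_of_mem_nhds (Iio_mem_nhds (lt_add_one x))]
    with y hy hy2 using ⟨hy, (mem_Iio.1 hy2).le⟩

namespace MemWeighted

variable {w f f' g g' h h' : ℝ → ℝ}

lemma aestronglyMeasurable_deriv (hf : MemWeighted w f f') :
    AEStronglyMeasurable f' (volume.restrict (Ioi 0)) := by
  have : Ioi (0:ℝ) ⊆ ⋃ n : ℕ, Icc (0:ℝ) n := fun x hx => by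
    obtain ⟨n, hn⟩ := exists_nat_ge x
    exact mem_iUnion.2 ⟨n, (mem_Ioi.1 hx).le, hn⟩
  exact (aestronglyMeasurable_iUnion_iff.2 fun n : ℕ =>
    (hf.integrableOn_Icc n n.cast_nonneg).aestronglyMeasurable).mono_set this

lemma intervalIntegrable (hf : MemWeighted w f f') {x y : ℝ} (hx : 0 ≤ x) (hxy : x ≤ y) :
    IntervalIntegrable f' volume x y := by
  rw [intervalIntegrable_iff_integrableOn_Icc_of_le hxy]
  exact (hf.integrableOn_Icc y (hx.trans hxy)).mono_set (Icc_subset_Icc_left hx)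

lemma sub (hw : ContinuousOn w (Ici 0)) (hw_ge : ∀ x ∈ Ici (0:ℝ), 1 ≤ w x)
    (hg : MemWeighted w g g') (hh : MemWeighted w h h') :
    MemWeighted w (fun x => g x - h x) (fun x => g' x - h' x) where
  integrableOn_Icc x hx := (hg.integrableOn_Icc x hx).sub (hh.integrableOn_Icc x hx)
  eq_add_integral x hx := by
    rw [intervalIntegral.integral_sub (hg.intervalIntegrable le_rfl hx)
      (hh.intervalIntegrable le_rfl hx), hg.eq_add_integral x hx, hh.eq_add_integral x hx]
    ring
  integrableOn_sq_mul := by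
    have hwm := (hw.mono Ioi_subset_Ici_self).aestronglyMeasurable (μ := volume) measurableSet_Ioi
    refine ((hg.integrableOn_sq_mul.add hh.integrableOn_sq_mul).const_mul 2).mono'
      ?_ ?_
    · have := hg.aestronglyMeasurable_deriv.sub hh.aestronglyMeasurable_deriv
      exact ((continuous_abs.comp_aestronglyMeasurable this).pow 2).mul hwm
    · filter_upwards [ae_restrict_mem measurableSet_Ioi] with x hx
      have h1 := hw_ge x (mem_Ioi.1 hx).le
      simp only [Pi.add_apply, sq_abs, Real.norm_eq_abs]
      rw [abs_of_nonneg (by positivity)]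
      nlinarith [mul_nonneg (sq_nonneg (g' x + h' x)) (zero_le_one.trans h1)]
  tendsto_zero := by simpa using hg.tendsto_zero.sub hh.tendsto_zero

lemma continuousOn (hf : MemWeighted w f f') : ContinuousOn f (Ici 0) :=
  (continuousOn_const.add (continuousOn_primitive_Ici hf.integrableOn_Icc)).congr
    fun y hy => hf.eq_add_integral y hy

lemma abs_le_sqrt_mul (hw_mono : MonotoneOn w (Ici 0)) (hw_ge : ∀ x ∈ Ici (0:ℝ), 1 ≤ w x)
    (hw_int : IntegrableOn (fun x => w x ^ (-(1/3) : ℝ)) (Ioi 0))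
    (hf : MemWeighted w f f') {x : ℝ} (hx : 0 ≤ x) :
    |f x| ≤ Real.sqrt (∫ y in Ioi (0:ℝ), w y ^ (-(1/3) : ℝ)) * weightedNorm w f f' *
      w x ^ (-(1/3) : ℝ) := by
  set v : ℝ → ℝ := fun y => w y ^ (-(1/3) : ℝ)
  set K := ∫ y in Ioi (0:ℝ), v y
  set A := weightedNorm w f f' ^ 2
  have hv0 : ∀ y, 0 ≤ y → 0 ≤ v y := fun y hy =>
    Real.rpow_nonneg (zero_le_one.trans (hw_ge y hy)) _
  have hK0 : 0 ≤ K := setIntegral_nonneg measurableSet_Ioi fun y hy => hv0 y (mem_Ioi.1 hy).le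
  have hvx := hv0 x hx
  have key : ∀ t : ℝ, 0 ≤ A * (t * t) + (-(2 * |f x|)) * t + v x ^ 2 * K := by
    intro t
    rcases le_or_gt t 0 with ht | ht
    · have h1 : 0 ≤ A * (t * t) := mul_nonneg (sq_nonneg _) (mul_self_nonneg t)
      have h2 : 0 ≤ v x ^ 2 * K := by positivity
      nlinarith [mul_nonneg (abs_nonneg (f x)) (neg_nonneg.2 ht)]
    have hI : IntegrableOn (fun y => t ^ 2 * (|f' y| ^ 2 * w y) + v x ^ 2 * v y) (Ioi 0) :=
      (hf.integrableOn_sq_mul.const_mul _).add (hw_int.const_mul _)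
    have hbound : ∀ y ≥ x, 2 * t * |f y - f x| ≤ A * (t * t) + v x ^ 2 * K := by
      intro y hy
      have hfy : f y - f x = ∫ s in x..y, f' s := by
        rw [hf.eq_add_integral y (hx.trans hy), hf.eq_add_integral x hx,
          ← intervalIntegral.integral_add_adjacent_intervals (hf.intervalIntegrable le_rfl hx)
            (hf.intervalIntegrable hx hy)]
        ring
      have hsub : Ioc x y ⊆ Ioi 0 := fun s hs => hx.trans_lt hs.1
      calc 2 * t * |f y - f x| ≤ 2 * t * ∫ s in x..y, |f' s| := by
            rw [hfy]
            gcongr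
            exact intervalIntegral.abs_integral_le_integral_abs hy
        _ = ∫ s in Ioc x y, 2 * t * |f' s| := by
            rw [intervalIntegral.integral_of_le hy, integral_const_mul]
        _ ≤ ∫ s in Ioc x y, (t ^ 2 * (|f' s| ^ 2 * w s) + v x ^ 2 * v s) := by
            refine setIntegral_mono_on ?_ (hI.mono_set hsub) measurableSet_Ioc fun s hs => ?_
            · exact ((hf.intervalIntegrable hx hy).1.abs).const_mul _
            · have hs0 : 0 ≤ s := hx.trans hs.1.le
              have hws := hw_ge s hs0
              have h3 : w s * v s ^ 3 = 1 := rpow_neg_third_pow_three hws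
              have hvs := hv0 s hs0
              have hle : v s ≤ v x := Real.rpow_le_rpow_of_nonpos
                (zero_lt_one.trans_le (hw_ge x hx)) (hw_mono hx hs0 hs.1.le) (by norm_num)
              have h4 : v s ^ 3 ≤ v x ^ 2 * v s := by
                calc v s ^ 3 = v s ^ 2 * v s := by ring
                  _ ≤ _ := by gcongr
              have h5 : 0 ≤ v s ^ 3 * (w s * (t * |f' s|) - 1) ^ 2 := by positivity
              have h6 : v s ^ 3 * (w s * (t * |f' s|) - 1) ^ 2 =
                  (w s * v s ^ 3) * (t ^ 2 * (|f' s| ^ 2 * w s)) -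
                    2 * t * |f' s| * (w s * v s ^ 3) + v s ^ 3 := by ring
              rw [h6, h3] at h5
              linarith
        _ ≤ ∫ s in Ioi 0, (t ^ 2 * (|f' s| ^ 2 * w s) + v x ^ 2 * v s) := by
            refine setIntegral_mono_set hI ?_ hsub.eventuallyLE
            filter_upwards [ae_restrict_mem measurableSet_Ioi] with s hs
            have hs0 : 0 ≤ s := (mem_Ioi.1 hs).le
            have := hw_ge s hs0
            have := hv0 s hs0
            simp only [Pi.zero_apply]
            positivity
        _ = t ^ 2 * (∫ s in Ioi 0, |f' s| ^ 2 * w s) + v x ^ 2 * K := by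
            rw [integral_add (hf.integrableOn_sq_mul.const_mul _) (hw_int.const_mul _),
              integral_const_mul, integral_const_mul]
        _ ≤ A * (t * t) + v x ^ 2 * K := by
            nlinarith [mul_le_mul_of_nonneg_left
              (integral_sq_mul_le_weightedNorm_sq hw_ge f f') (sq_nonneg t)]
    have hlim : Tendsto (fun y => 2 * t * |f y - f x|) atTop (nhds (2 * t * |0 - f x|)) :=
      ((hf.tendsto_zero.sub_const _).abs).const_mul _
    have := le_of_tendsto hlim ((eventually_ge_atTop x).mono hbound)
    rw [zero_sub, abs_neg] at this
    linarith
  have hd := discrim_le_zero key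
  rw [discrim] at hd
  have hN := weightedNorm_nonneg w f f'
  refine abs_le_of_sq_le_sq ?_ (by positivity)
  rw [mul_pow, mul_pow, Real.sq_sqrt hK0]
  nlinarith [sq_abs (f x)]

lemma integrableOn_Ioi (hw_mono : MonotoneOn w (Ici 0)) (hw_ge : ∀ x ∈ Ici (0:ℝ), 1 ≤ w x)
    (hw_int : IntegrableOn (fun x => w x ^ (-(1/3) : ℝ)) (Ioi 0)) (hf : MemWeighted w f f') :
    IntegrableOn f (Ioi 0) := by
  refine (hw_int.const_mul (Real.sqrt (∫ y in Ioi (0:ℝ), w y ^ (-(1/3) : ℝ)) *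
    weightedNorm w f f')).mono'
    ((hf.continuousOn.mono Ioi_subset_Ici_self).aestronglyMeasurable measurableSet_Ioi) ?_
  filter_upwards [ae_restrict_mem measurableSet_Ioi] with x hx
  exact hf.abs_le_sqrt_mul hw_mono hw_ge hw_int (mem_Ioi.1 hx).le

lemma intervalIntegrable_zero (hf : MemWeighted w f f') {x : ℝ} (hx : 0 ≤ x) :
    IntervalIntegrable f volume 0 x :=
  (hf.continuousOn.mono (by rw [uIcc_of_le hx]; exact Icc_subset_Ici_self)).intervalIntegrable

lemma continuousOn_integral (hf : MemWeighted w f f') :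
    ContinuousOn (fun x => ∫ s in (0:ℝ)..x, f s) (Ici 0) :=
  continuousOn_primitive_Ici fun _ _ =>
    (hf.continuousOn.mono Icc_subset_Ici_self).integrableOn_Icc

lemma abs_integral_le (hw_mono : MonotoneOn w (Ici 0)) (hw_ge : ∀ x ∈ Ici (0:ℝ), 1 ≤ w x)
    (hw_int : IntegrableOn (fun x => w x ^ (-(1/3) : ℝ)) (Ioi 0))
    (hf : MemWeighted w f f') {x : ℝ} (hx : 0 ≤ x) :
    |∫ s in (0:ℝ)..x, f s| ≤ Real.sqrt (∫ y in Ioi (0:ℝ), w y ^ (-(1/3) : ℝ)) *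
      weightedNorm w f f' * ∫ y in Ioi (0:ℝ), w y ^ (-(1/3) : ℝ) := by
  calc |∫ s in (0:ℝ)..x, f s| ≤ ∫ s in (0:ℝ)..x, |f s| :=
        intervalIntegral.abs_integral_le_integral_abs hx
    _ = ∫ s in Ioc 0 x, |f s| := intervalIntegral.integral_of_le hx
    _ ≤ ∫ s in Ioi 0, |f s| :=
        setIntegral_mono_set (hf.integrableOn_Ioi hw_mono hw_ge hw_int).abs
          (Eventually.of_forall fun s => abs_nonneg _) Ioc_subset_Ioi_self.eventuallyLE
    _ ≤ ∫ s in Ioi (0:ℝ), Real.sqrt (∫ y in Ioi (0:ℝ), w y ^ (-(1/3) : ℝ)) *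
          weightedNorm w f f' * w s ^ (-(1/3) : ℝ) :=
        setIntegral_mono_on (hf.integrableOn_Ioi hw_mono hw_ge hw_int).abs
          (hw_int.const_mul _) measurableSet_Ioi fun s hs =>
            hf.abs_le_sqrt_mul hw_mono hw_ge hw_int (mem_Ioi.1 hs).le
    _ = _ := integral_const_mul _ _

end MemWeighted

/-- local Lipschitz continuity of the HJM drift operator `S`:
there is `C > 0` (depending only on `w`) such that for all `g, h ∈ H_w^0`,
`‖Sg − Sh‖_w ≤ C (‖g‖_w + ‖h‖_w) ‖g − h‖_w`, where `(Sf)(x) = f(x)∫_0^x f(η)dη`,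
`(Sf)'(x) = f'(x)∫_0^x f + f(x)²`, and `‖f‖_w = (|f(0)|² + ∫_0^∞ |f'|² w)^{1/2}`. -/
theorem stmt_14
    (w : ℝ → ℝ) (hw_c1 : ContDiffOn ℝ 1 w (Ici 0))
    (hw_mono : MonotoneOn w (Ici 0)) (hw_ge : ∀ x ∈ Ici (0:ℝ), 1 ≤ w x)
    (hw_int : IntegrableOn (fun x => w x ^ (-(1/3) : ℝ)) (Ioi 0)) :
    ∃ C > (0:ℝ), ∀ g g' h h' : ℝ → ℝ,
      (∀ x ≥ (0:ℝ), IntegrableOn g' (Icc 0 x)) →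
      (∀ x ≥ (0:ℝ), g x = g 0 + ∫ s in (0:ℝ)..x, g' s) →
      IntegrableOn (fun x => |g' x| ^ 2 * w x) (Ioi 0) →
      Tendsto g atTop (nhds 0) →
      (∀ x ≥ (0:ℝ), IntegrableOn h' (Icc 0 x)) →
      (∀ x ≥ (0:ℝ), h x = h 0 + ∫ s in (0:ℝ)..x, h' s) →
      IntegrableOn (fun x => |h' x| ^ 2 * w x) (Ioi 0) →
      Tendsto h atTop (nhds 0) →
      IntegrableOn (fun x =>
        |(g' x * (∫ η in (0:ℝ)..x, g η) + (g x) ^ 2) -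
          (h' x * (∫ η in (0:ℝ)..x, h η) + (h x) ^ 2)| ^ 2 * w x) (Ioi 0) ∧
      Real.sqrt (|g 0 * (∫ η in (0:ℝ)..(0:ℝ), g η) -
            h 0 * (∫ η in (0:ℝ)..(0:ℝ), h η)| ^ 2 +
          ∫ x in Ioi (0:ℝ),
            |(g' x * (∫ η in (0:ℝ)..x, g η) + (g x) ^ 2) -
              (h' x * (∫ η in (0:ℝ)..x, h η) + (h x) ^ 2)| ^ 2 * w x)
        ≤ C * (Real.sqrt (|g 0| ^ 2 + ∫ x in Ioi (0:ℝ), |g' x| ^ 2 * w x) +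
              Real.sqrt (|h 0| ^ 2 + ∫ x in Ioi (0:ℝ), |h' x| ^ 2 * w x)) *
            Real.sqrt (|g 0 - h 0| ^ 2 +
              ∫ x in Ioi (0:ℝ), |g' x - h' x| ^ 2 * w x) := by
  set v : ℝ → ℝ := fun y => w y ^ (-(1/3) : ℝ)
  set K := ∫ y in Ioi (0:ℝ), v y
  have hv0 : ∀ y, 0 ≤ y → 0 ≤ v y := fun y hy =>
    Real.rpow_nonneg (zero_le_one.trans (hw_ge y hy)) _
  have hK0 : 0 ≤ K := setIntegral_nonneg measurableSet_Ioi fun y hy => hv0 y (mem_Ioi.1 hy).le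
  have hwc := hw_c1.continuousOn
  refine ⟨Real.sqrt (6 * K ^ 3) + 1, by positivity, ?_⟩
  intro g g' h h' hg1 hg2 hg3 hg4 hh1 hh2 hh3 hh4
  have hg : MemWeighted w g g' := ⟨hg1, hg2, hg3, hg4⟩
  have hh : MemWeighted w h h' := ⟨hh1, hh2, hh3, hh4⟩
  have hu := hg.sub hwc hw_ge hh
  change _ ∧ _ ≤ _ * (weightedNorm w g g' + weightedNorm w h h') *
    weightedNorm w (fun x => g x - h x) (fun x => g' x - h' x)
  have hG := integral_sq_mul_le_weightedNorm_sq hw_ge g g'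
  have hU := integral_sq_mul_le_weightedNorm_sq hw_ge (fun x => g x - h x) (fun x => g' x - h' x)
  have hpu := fun x (hx : 0 ≤ x) => hu.abs_le_sqrt_mul hw_mono hw_ge hw_int hx
  have hpg := fun x (hx : 0 ≤ x) => hg.abs_le_sqrt_mul hw_mono hw_ge hw_int hx
  have hph := fun x (hx : 0 ≤ x) => hh.abs_le_sqrt_mul hw_mono hw_ge hw_int hx
  have hiu := fun x (hx : 0 ≤ x) => hu.abs_integral_le hw_mono hw_ge hw_int hx
  have hih := fun x (hx : 0 ≤ x) => hh.abs_integral_le hw_mono hw_ge hw_int hx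
  have hNg := weightedNorm_nonneg w g g'
  have hNh := weightedNorm_nonneg w h h'
  have hNu := weightedNorm_nonneg w (fun x => g x - h x) (fun x => g' x - h' x)
  set Ng := weightedNorm w g g'
  set Nh := weightedNorm w h h'
  set Nu := weightedNorm w (fun x => g x - h x) (fun x => g' x - h' x)
  set D : ℝ → ℝ := fun x => |(g' x * (∫ η in (0:ℝ)..x, g η) + (g x) ^ 2) -
    (h' x * (∫ η in (0:ℝ)..x, h η) + (h x) ^ 2)| ^ 2 * w x with hD
  set B : ℝ → ℝ := fun x => 3 * K ^ 3 * Nu ^ 2 * (|g' x| ^ 2 * w x) +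
    3 * K ^ 3 * Nh ^ 2 * (|g' x - h' x| ^ 2 * w x) +
    3 * K ^ 2 * Nu ^ 2 * (Ng + Nh) ^ 2 * v x with hB
  have hBint1 : IntegrableOn (fun x => 3 * K ^ 3 * Nu ^ 2 * (|g' x| ^ 2 * w x) +
      3 * K ^ 3 * Nh ^ 2 * (|g' x - h' x| ^ 2 * w x)) (Ioi 0) := (hg3.const_mul (3 * K ^ 3 * Nu ^ 2)).add
    (hu.integrableOn_sq_mul.const_mul (3 * K ^ 3 * Nh ^ 2))
  have hBint2 := hw_int.const_mul (3 * K ^ 2 * Nu ^ 2 * (Ng + Nh) ^ 2)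
  have hBint : IntegrableOn B (Ioi 0) := hBint1.add hBint2
  have hD0 : ∀ x ∈ Ioi (0:ℝ), 0 ≤ D x := fun x hx =>
    mul_nonneg (by positivity) (zero_le_one.trans (hw_ge x (mem_Ioi.1 hx).le))
  have hDB : ∀ x ∈ Ioi (0:ℝ), D x ≤ B x := by
    intro x hx
    have hx0 : 0 ≤ x := (mem_Ioi.1 hx).le
    have hwx := hw_ge x hx0
    have h3 : w x * v x ^ 3 = 1 := rpow_neg_third_pow_three hwx
    have hvx := hv0 x hx0
    have e1 : ∫ η in (0:ℝ)..x, (g η - h η) =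
        (∫ η in (0:ℝ)..x, g η) - ∫ η in (0:ℝ)..x, h η :=
      intervalIntegral.integral_sub (hg.intervalIntegrable_zero hx0)
        (hh.intervalIntegrable_zero hx0)
    have b1 := hiu x hx0
    have b2 := hih x hx0
    have b3 := hpu x hx0
    have b4 : |g x + h x| ≤ Real.sqrt K * (Ng + Nh) * v x := by
      have := abs_add_le (g x) (h x)
      have := hpg x hx0
      have := hph x hx0
      linarith
    rw [e1] at b1
    have sqK : Real.sqrt K ^ 2 = K := Real.sq_sqrt hK0
    have c1 : ((∫ η in (0:ℝ)..x, g η) - ∫ η in (0:ℝ)..x, h η) ^ 2 ≤ K ^ 3 * Nu ^ 2 := by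
      calc _ = |(∫ η in (0:ℝ)..x, g η) - ∫ η in (0:ℝ)..x, h η| ^ 2 := (sq_abs _).symm
        _ ≤ (Real.sqrt K * Nu * K) ^ 2 := by gcongr
        _ = Real.sqrt K ^ 2 * (K ^ 2 * Nu ^ 2) := by ring
        _ = K ^ 3 * Nu ^ 2 := by rw [sqK]; ring
    have c2 : (∫ η in (0:ℝ)..x, h η) ^ 2 ≤ K ^ 3 * Nh ^ 2 := by
      calc _ = |∫ η in (0:ℝ)..x, h η| ^ 2 := (sq_abs _).symm
        _ ≤ (Real.sqrt K * Nh * K) ^ 2 := by gcongr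
        _ = Real.sqrt K ^ 2 * (K ^ 2 * Nh ^ 2) := by ring
        _ = K ^ 3 * Nh ^ 2 := by rw [sqK]; ring
    have c3 : ((g x - h x) * (g x + h x)) ^ 2 * w x ≤
        K ^ 2 * Nu ^ 2 * (Ng + Nh) ^ 2 * v x := by
      calc _ = (|g x - h x| * |g x + h x|) ^ 2 * w x := by rw [← abs_mul, sq_abs]
        _ ≤ ((Real.sqrt K * Nu * v x) * (Real.sqrt K * (Ng + Nh) * v x)) ^ 2 * w x := by
            gcongr
        _ = (Real.sqrt K ^ 2) ^ 2 * Nu ^ 2 * (Ng + Nh) ^ 2 * v x * (w x * v x ^ 3) := by ring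
        _ = _ := by rw [sqK, h3, mul_one]
    simp only [hD, hB, sq_abs]
    set G := ∫ η in (0:ℝ)..x, g η
    set H := ∫ η in (0:ℝ)..x, h η
    have e2 : g' x * G + g x ^ 2 - (h' x * H + h x ^ 2) =
        g' x * (G - H) + (g' x - h' x) * H + (g x - h x) * (g x + h x) := by ring
    have three : ∀ a b c : ℝ, (a + b + c) ^ 2 ≤ 3 * (a ^ 2 + b ^ 2 + c ^ 2) := fun a b c => by
      nlinarith [sq_nonneg (a - b), sq_nonneg (b - c), sq_nonneg (a - c)]
    rw [e2]
    calc _ ≤ 3 * ((g' x * (G - H)) ^ 2 + ((g' x - h' x) * H) ^ 2 +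
          ((g x - h x) * (g x + h x)) ^ 2) * w x := by
          gcongr
          exact three _ _ _
      _ = 3 * (G - H) ^ 2 * (g' x ^ 2 * w x) + 3 * H ^ 2 * ((g' x - h' x) ^ 2 * w x) +
          3 * (((g x - h x) * (g x + h x)) ^ 2 * w x) := by ring
      _ ≤ 3 * (K ^ 3 * Nu ^ 2) * (g' x ^ 2 * w x) +
          3 * (K ^ 3 * Nh ^ 2) * ((g' x - h' x) ^ 2 * w x) +
          3 * (K ^ 2 * Nu ^ 2 * (Ng + Nh) ^ 2 * v x) := by gcongr
      _ = _ := by ring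
  have hDint : IntegrableOn D (Ioi 0) := by
    refine hBint.mono' ?_ ?_
    · have m : ∀ {φ : ℝ → ℝ}, ContinuousOn φ (Ici 0) →
          AEStronglyMeasurable φ (volume.restrict (Ioi 0)) := fun hφ =>
        (hφ.mono Ioi_subset_Ici_self).aestronglyMeasurable measurableSet_Ioi
      have m1 := ((hg.aestronglyMeasurable_deriv.mul (m hg.continuousOn_integral)).add
        ((m hg.continuousOn).pow 2)).sub
        ((hh.aestronglyMeasurable_deriv.mul (m hh.continuousOn_integral)).add
        ((m hh.continuousOn).pow 2))
      exact ((continuous_abs.comp_aestronglyMeasurable m1).pow 2).mul (m hwc)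
    · filter_upwards [ae_restrict_mem measurableSet_Ioi] with x hx
      rw [Real.norm_of_nonneg (hD0 x hx)]
      exact hDB x hx
  refine ⟨hDint, ?_⟩
  have hle : ∫ x in Ioi (0:ℝ), D x ≤ 6 * K ^ 3 * ((Ng + Nh) * Nu) ^ 2 := by
    calc ∫ x in Ioi (0:ℝ), D x ≤ ∫ x in Ioi (0:ℝ), B x :=
          setIntegral_mono_on hDint hBint measurableSet_Ioi hDB
      _ = 3 * K ^ 3 * Nu ^ 2 * (∫ x in Ioi (0:ℝ), |g' x| ^ 2 * w x) +
          3 * K ^ 3 * Nh ^ 2 * (∫ x in Ioi (0:ℝ), |g' x - h' x| ^ 2 * w x) +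
          3 * K ^ 2 * Nu ^ 2 * (Ng + Nh) ^ 2 * K := by
          rw [hB, integral_add hBint1 hBint2, integral_add (hg3.const_mul _)
              (hu.integrableOn_sq_mul.const_mul _), integral_const_mul, integral_const_mul,
            integral_const_mul]
      _ ≤ 3 * K ^ 3 * Nu ^ 2 * Ng ^ 2 + 3 * K ^ 3 * Nh ^ 2 * Nu ^ 2 +
          3 * K ^ 2 * Nu ^ 2 * (Ng + Nh) ^ 2 * K := by gcongr
      _ = 6 * K ^ 3 * ((Ng + Nh) * Nu) ^ 2 - 6 * K ^ 3 * Nu ^ 2 * (Ng * Nh) := by ring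
      _ ≤ _ := sub_le_self _ (by positivity)
  simp only [intervalIntegral.integral_same, mul_zero, sub_zero, abs_zero, ne_eq,
    OfNat.ofNat_ne_zero, not_false_eq_true, zero_pow, zero_add]
  calc Real.sqrt (∫ x in Ioi (0:ℝ), D x) ≤ Real.sqrt (6 * K ^ 3 * ((Ng + Nh) * Nu) ^ 2) :=
        Real.sqrt_le_sqrt hle
    _ = Real.sqrt (6 * K ^ 3) * ((Ng + Nh) * Nu) := by
        rw [Real.sqrt_mul (by positivity), Real.sqrt_sq (by positivity)]
    _ ≤ (Real.sqrt (6 * K ^ 3) + 1) * ((Ng + Nh) * Nu) := by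
        gcongr
        linarith
    _ = _ := by ring
end

section
/- (The weight (1+x)³(log(2+x))⁶ satisfies Filipović's condition but not the stronger asymptotics.) Let w(x) := (1+x)³ (log(2+x))⁶ for x ≥ 0. Then (a) ∫_0^∞ w(x)^{-1/3} dx < ∞, and (b) for every ε > 0, lim_{x→∞} x^{3+ε} / w(x) = ∞; in particular there exist no constants K₀ > 0, ε > 0 with 1/w(x) ≤ K₀ x^{-(3+ε)} for all x ≥ 1. -/
open MeasureTheory Set Filter

lemma weight_pos {x : ℝ} (hx : 0 ≤ x) : 0 < (1 + x) ^ 3 * (Real.log (2 + x)) ^ 6 := by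
  have hlog : 0 < Real.log (2 + x) := Real.log_pos (by linarith)
  positivity

lemma weight_rpow_neg_third {x : ℝ} (hx : 0 ≤ x) :
    ((1 + x) ^ 3 * (Real.log (2 + x)) ^ 6) ^ (-(1/3) : ℝ) =
      ((1 + x) * (Real.log (2 + x)) ^ 2)⁻¹ := by
  have hlog : 0 < Real.log (2 + x) := Real.log_pos (by linarith)
  have hbase : 0 ≤ (1 + x) * (Real.log (2 + x)) ^ 2 := by positivity
  have hcube : (1 + x) ^ 3 * (Real.log (2 + x)) ^ 6 =
      ((1 + x) * (Real.log (2 + x)) ^ 2) ^ (3 : ℝ) := by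
    norm_cast
    ring
  rw [hcube, ← Real.rpow_mul hbase, ← Real.rpow_neg_one]
  norm_num

lemma integrableOn_inv_mul_log_sq :
    IntegrableOn (fun x : ℝ => ((2 + x) * (Real.log (2 + x)) ^ 2)⁻¹) (Ioi 0) := by
  refine integrableOn_Ioi_deriv_of_nonneg' (g := fun x => -(Real.log (2 + x))⁻¹) (l := -0)
    (fun x hx => ?_) (fun x hx => ?_) ?_
  · have hx : 0 ≤ x := hx
    have hlog : 0 < Real.log (2 + x) := Real.log_pos (by linarith)
    have h := ((((hasDerivAt_id x).const_add 2).log (by simp; linarith)).inv hlog.ne').neg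
    refine h.congr_deriv ?_
    simp only [id]
    field_simp
  · have hx : 0 < x := hx
    positivity
  · exact (Real.tendsto_log_atTop.comp
      (tendsto_atTop_add_const_left atTop 2 tendsto_id)).inv_tendsto_atTop.neg

lemma integrableOn_weight_rpow_neg_third :
    IntegrableOn
      (fun x : ℝ => ((1 + x) ^ 3 * (Real.log (2 + x)) ^ 6) ^ (-(1/3) : ℝ)) (Ioi 0) := by
  refine (integrableOn_inv_mul_log_sq.const_mul 2).mono'
    (Measurable.aestronglyMeasurable (by fun_prop)) ?_
  refine (ae_restrict_iff' measurableSet_Ioi).2 (Eventually.of_forall fun x hx => ?_)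
  have hx : 0 < x := hx
  have hlog : 0 < Real.log (2 + x) := Real.log_pos (by linarith)
  rw [weight_rpow_neg_third hx.le, Real.norm_of_nonneg (by positivity), ← div_eq_mul_inv,
    inv_eq_one_div, div_le_div_iff₀ (by positivity) (by positivity)]
  nlinarith [mul_nonneg hx.le (sq_nonneg (Real.log (2 + x)))]

lemma weight_le_rpow {δ : ℝ} (hδ : 0 < δ) {x : ℝ} (hx : 2 ≤ x) :
    (1 + x) ^ 3 * (Real.log (2 + x)) ^ 6 ≤ 8 * (2 ^ δ / δ) ^ 6 * x ^ (3 + 6 * δ) := by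
  have hx0 : 0 < x := by linarith
  have hlog0 : 0 ≤ Real.log (2 + x) := Real.log_nonneg (by linarith)
  have hlog : Real.log (2 + x) ≤ 2 ^ δ / δ * x ^ δ :=
    calc Real.log (2 + x) ≤ Real.log (2 * x) := Real.log_le_log (by linarith) (by linarith)
      _ ≤ (2 * x) ^ δ / δ := Real.log_le_rpow_div (by linarith) hδ
      _ = 2 ^ δ / δ * x ^ δ := by
        rw [Real.mul_rpow (by norm_num) hx0.le]
        ring
  have hpow : x ^ (3 + 6 * δ) = x ^ 3 * (x ^ δ) ^ 6 := by
    rw [Real.rpow_add hx0, mul_comm 6 δ, Real.rpow_mul hx0.le]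
    norm_cast
  calc (1 + x) ^ 3 * (Real.log (2 + x)) ^ 6
      ≤ (2 * x) ^ 3 * (2 ^ δ / δ * x ^ δ) ^ 6 := by
        gcongr
        linarith
    _ = 8 * (2 ^ δ / δ) ^ 6 * x ^ (3 + 6 * δ) := by
        rw [hpow]
        ring

lemma tendsto_rpow_div_weight {ε : ℝ} (hε : 0 < ε) :
    Tendsto (fun x : ℝ => x ^ (3 + ε) / ((1 + x) ^ 3 * (Real.log (2 + x)) ^ 6))
      atTop atTop := by
  have hδ : 0 < ε / 12 := by positivity
  have hC : 0 < 8 * ((2 : ℝ) ^ (ε / 12) / (ε / 12)) ^ 6 := by positivity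
  refine tendsto_atTop_mono' atTop ?_
    ((tendsto_rpow_atTop (half_pos hε)).atTop_div_const hC)
  filter_upwards [eventually_ge_atTop (2 : ℝ)] with x hx
  have hx0 : 0 < x := by linarith
  rw [div_le_div_iff₀ hC (weight_pos hx0.le)]
  calc x ^ (ε / 2) * ((1 + x) ^ 3 * (Real.log (2 + x)) ^ 6)
      ≤ x ^ (ε / 2) * (8 * (2 ^ (ε / 12) / (ε / 12)) ^ 6 * x ^ (3 + 6 * (ε / 12))) :=
        mul_le_mul_of_nonneg_left (weight_le_rpow hδ hx) (by positivity)
    _ = x ^ (3 + ε) * (8 * (2 ^ (ε / 12) / (ε / 12)) ^ 6) := by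
        rw [show 3 + ε = ε / 2 + (3 + 6 * (ε / 12)) by ring, Real.rpow_add hx0 (ε / 2)]
        ring

/-- the weight `w(x) = (1+x)³(log(2+x))⁶` satisfies Filipović's condition
`∫_0^∞ w^{-1/3} < ∞`, but `x^{3+ε}/w(x) → ∞` for every `ε > 0`; in particular there are
no `K₀ > 0`, `ε > 0` with `1/w(x) ≤ K₀ x^{-(3+ε)}` for all `x ≥ 1`. -/
theorem stmt_15 :
    IntegrableOn
      (fun x : ℝ => ((1 + x) ^ 3 * (Real.log (2 + x)) ^ 6) ^ (-(1/3) : ℝ)) (Ioi 0) ∧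
    (∀ ε > (0:ℝ),
      Tendsto (fun x : ℝ => x ^ (3 + ε) / ((1 + x) ^ 3 * (Real.log (2 + x)) ^ 6))
        atTop atTop) ∧
    ¬ ∃ K₀ > (0:ℝ), ∃ ε > (0:ℝ), ∀ x ≥ (1:ℝ),
        ((1 + x) ^ 3 * (Real.log (2 + x)) ^ 6)⁻¹ ≤ K₀ * x ^ (-(3 + ε)) := by
  refine ⟨integrableOn_weight_rpow_neg_third, fun ε hε => tendsto_rpow_div_weight hε, ?_⟩
  rintro ⟨K₀, -, ε, hε, hbound⟩
  obtain ⟨x, hx1, hxK⟩ := ((eventually_ge_atTop (1 : ℝ)).and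
    ((tendsto_rpow_div_weight hε).eventually_gt_atTop K₀)).exists
  have hx0 : 0 < x := by linarith
  have hpow : 0 < x ^ (3 + ε) := Real.rpow_pos_of_pos hx0 _
  have h := hbound x hx1
  rw [Real.rpow_neg hx0.le, ← div_eq_mul_inv, le_div_iff₀ hpow, mul_comm,
    ← div_eq_mul_inv] at h
  exact hxK.not_ge h
end
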